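/- Let R₀ be an invertible 3×3 real matrix, let d ≠ 0 be a real number, N ≥ 1, and a₁, …, a_N ∈ ℝ³. Define the 3×(3N) real matrix Δ = R₀ · K, where K = [d·I₃ + a₁^× | … | d·I₃ + a_N^×] is the horizontal stack of the blocks d·I₃ + aᵢ^×. Then Δ·Δᵀ is an invertible 3×3 matrix and the (3N)×3 matrix Δ† := Δᵀ·(Δ·Δᵀ)⁻¹ is a right inverse of Δ, i.e. Δ·Δ† = I₃. -/

import Mathlib

open Matrix

/-- The hat map: for `a ∈ ℝ³`, `hat a` is the skew-symmetric matrix with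
`(hat a) * v = a × v` for all `v`. -/
def hat (a : Fin 3 → ℝ) : Matrix (Fin 3) (Fin 3) ℝ :=
  !![0, -a 2, a 1;
     a 2, 0, -a 0;
     -a 1, a 0, 0]

/-- The horizontal stack `K = [d·I₃ + a₁^× | ⋯ | d·I₃ + a_N^×]` as a
`3 × (3N)` matrix, with columns indexed by `Fin N × Fin 3`. -/
def hstack (N : ℕ) (d : ℝ) (a : Fin N → Fin 3 → ℝ) :
    Matrix (Fin 3) (Fin N × Fin 3) ℝ :=
  Matrix.of fun i p => (d • (1 : Matrix (Fin 3) (Fin 3) ℝ) + hat (a p.1)) i p.2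

lemma hstack_gram_isUnit (N : ℕ) (hN : 1 ≤ N) (d : ℝ) (hd : d ≠ 0) (a : Fin N → Fin 3 → ℝ) :
    IsUnit (hstack N d a * (hstack N d a)ᵀ) := by
  rw [← Matrix.mulVec_injective_iff_isUnit, ← Matrix.coe_mulVecLin, ← LinearMap.ker_eq_bot,
    LinearMap.ker_eq_bot']
  intro v hv
  rw [Matrix.mulVecLin_apply, ← Matrix.conjTranspose_eq_transpose_of_trivial,
    Matrix.self_mul_conjTranspose_mulVec_eq_zero,
    Matrix.conjTranspose_eq_transpose_of_trivial] at hv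
  have h0 := congrFun hv (⟨0, hN⟩, 0)
  have h1 := congrFun hv (⟨0, hN⟩, 1)
  have h2 := congrFun hv (⟨0, hN⟩, 2)
  simp [Matrix.mulVec, dotProduct, hstack, hat, Fin.sum_univ_three] at h0 h1 h2
  have h : d * (v 0 ^ 2 + v 1 ^ 2 + v 2 ^ 2) = 0 := by
    linear_combination v 0 * h0 + v 1 * h1 + v 2 * h2
  have h' := (mul_eq_zero.mp h).resolve_left hd
  ext j
  fin_cases j <;> simp <;> nlinarith [sq_nonneg (v 0), sq_nonneg (v 1), sq_nonneg (v 2)]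

/-- Theorem 1 of the paper: the feedback-linearization matrix
`Δ = R₀ · K` admits a Moore–Penrose right inverse `Δ† = Δᵀ (Δ Δᵀ)⁻¹`
with `Δ Δ† = I₃`. -/
theorem delta_has_right_inverse (N : ℕ) (hN : 1 ≤ N)
    (R₀ : Matrix (Fin 3) (Fin 3) ℝ) (hR₀ : IsUnit R₀)
    (d : ℝ) (hd : d ≠ 0) (a : Fin N → Fin 3 → ℝ) :
    IsUnit (R₀ * hstack N d a * (R₀ * hstack N d a)ᵀ) ∧
      R₀ * hstack N d a *
          ((R₀ * hstack N d a)ᵀ * (R₀ * hstack N d a * (R₀ * hstack N d a)ᵀ)⁻¹)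
        = (1 : Matrix (Fin 3) (Fin 3) ℝ) := by
  have hu : IsUnit (R₀ * hstack N d a * (R₀ * hstack N d a)ᵀ) := by
    have h := (hR₀.mul (hstack_gram_isUnit N hN d hd a)).mul
      ((Matrix.isUnit_transpose (A := R₀)).mpr hR₀)
    simpa only [Matrix.transpose_mul, Matrix.mul_assoc] using h
  refine ⟨hu, ?_⟩
  rw [← Matrix.mul_assoc]
  exact Matrix.mul_nonsing_inv _ ((Matrix.isUnit_iff_isUnit_det _).mp hu)
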